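/- Let m ∈ ℕ and a, b, s ∈ ℝ satisfy a + b ≥ 0, s ≤ min{a, b}, and s ≤ a + b − m/2, with the last inequality strict if −s = m/2 or a = m/2 or b = m/2. Then there exists C > 0 such that for all Schwartz functions f, g ∈ 𝒮(ℝ^m) one has ‖⟨·⟩^s 𝓕(fg)‖_{L²(ℝ^m)} ≤ C · ‖⟨·⟩^a 𝓕f‖_{L²(ℝ^m)} · ‖⟨·⟩^b 𝓕g‖_{L²(ℝ^m)}, where fg denotes the pointwise product and 𝓕 the Fourier transform. -/

import Mathlib

open scoped ENNReal FourierTransform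
open MeasureTheory

/-- The Japanese bracket `⟨x⟩ = (1 + |x|²)^(1/2)`. -/
noncomputable def jb {E : Type*} [NormedAddCommGroup E] (x : E) : ℝ :=
  Real.sqrt (1 + ‖x‖ ^ 2)

section JapaneseBracket

variable {E : Type*} [NormedAddCommGroup E]

lemma one_le_jb (x : E) : 1 ≤ jb x :=
  Real.one_le_sqrt.2 (by nlinarith [sq_nonneg ‖x‖])

lemma jb_pos (x : E) : 0 < jb x := zero_lt_one.trans_le (one_le_jb x)

lemma norm_lt_jb (x : E) : ‖x‖ < jb x :=
  Real.lt_sqrt_of_sq_lt (by linarith)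

lemma jb_add_le (x y : E) : jb (x + y) ≤ jb x + jb y := by
  have hx : jb x ^ 2 = 1 + ‖x‖ ^ 2 := Real.sq_sqrt (by positivity)
  have hy : jb y ^ 2 = 1 + ‖y‖ ^ 2 := Real.sq_sqrt (by positivity)
  refine Real.sqrt_le_iff.2 ⟨add_nonneg (jb_pos x).le (jb_pos y).le, ?_⟩
  have h1 : ‖x + y‖ ^ 2 ≤ (‖x‖ + ‖y‖) ^ 2 := by gcongr; exact norm_add_le x y
  have h2 : ‖x‖ * ‖y‖ ≤ jb x * jb y :=
    mul_le_mul (norm_lt_jb x).le (norm_lt_jb y).le (norm_nonneg y) (jb_pos x).le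
  nlinarith

lemma jb_neg (x : E) : jb (-x) = jb x := by simp [jb]

@[fun_prop]
lemma continuous_jb : Continuous (jb : E → ℝ) := by
  unfold jb; fun_prop

@[fun_prop]
lemma measurable_jb [MeasurableSpace E] [OpensMeasurableSpace E] : Measurable (jb : E → ℝ) :=
  continuous_jb.measurable

lemma jb_rpow_eq (x : E) (r : ℝ) : jb x ^ r = (1 + ‖x‖ ^ 2) ^ (r / 2) := by
  rw [jb, Real.sqrt_eq_rpow, ← Real.rpow_mul (by positivity)]
  congr 1; ring

end JapaneseBracket

lemma ofReal_rpow_two_mul {t : ℝ} (ht : 0 ≤ t) (r : ℝ) :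
    ENNReal.ofReal (t ^ (2 * r)) = ENNReal.ofReal (t ^ r) ^ 2 := by
  rw [← ENNReal.ofReal_pow (by positivity), mul_comm, Real.rpow_mul ht]
  norm_cast

lemma rpow_le_two_rpow_abs_mul {q r : ℝ} (hq : 0 < q) (hr : 0 < r) (hqr : q ≤ 2 * r)
    (hrq : r ≤ 2 * q) (β : ℝ) : q ^ β ≤ 2 ^ |β| * r ^ β := by
  rcases le_total 0 β with hβ | hβ
  · rw [abs_of_nonneg hβ, ← Real.mul_rpow (by norm_num) hr.le]
    exact Real.rpow_le_rpow hq.le hqr hβ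
  · rw [abs_of_nonpos hβ, Real.rpow_neg (by norm_num), ← Real.inv_rpow (by norm_num),
      ← Real.mul_rpow (by norm_num) hr.le]
    exact Real.rpow_le_rpow_of_nonpos (by positivity) (by linarith) hβ

lemma sq_lintegral_mul_le {α : Type*} [MeasurableSpace α] (μ : Measure α) {f g : α → ℝ≥0∞}
    (hf : Measurable f) (hg : Measurable g) :
    (∫⁻ x, f x * g x ∂μ) ^ 2 ≤ (∫⁻ x, f x ^ 2 ∂μ) * ∫⁻ x, g x ^ 2 ∂μ := by
  have h := ENNReal.lintegral_mul_le_Lp_mul_Lq μ Real.HolderConjugate.two_two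
    hf.aemeasurable hg.aemeasurable
  simp only [Pi.mul_apply, ENNReal.rpow_two] at h
  calc _ ≤ ((∫⁻ x, f x ^ 2 ∂μ) ^ (1 / 2 : ℝ) * (∫⁻ x, g x ^ 2 ∂μ) ^ (1 / 2 : ℝ)) ^ 2 := by gcongr
    _ = _ := by
      rw [mul_pow, ← ENNReal.rpow_two, ← ENNReal.rpow_two, ← ENNReal.rpow_mul,
        ← ENNReal.rpow_mul]
      norm_num

section Convolution

variable {E : Type*} [NormedAddCommGroup E] [MeasurableSpace E] [BorelSpace E]
  {μ : Measure E} [SFinite μ] [μ.IsAddLeftInvariant]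

/-- An `L²` bound for a weighted convolution whose kernel is uniformly square integrable in the
inner variable. -/
lemma lintegral_sq_convolution_le_of_inner [SecondCountableTopology E] {k : E → E → ℝ≥0∞}
    (hk : Measurable (Function.uncurry k)) {U V : E → ℝ≥0∞} (hU : Measurable U)
    (hV : Measurable V) {C : ℝ≥0∞} (hC : ∀ ξ, ∫⁻ η, k ξ η ^ 2 ∂μ ≤ C) :
    ∫⁻ ξ, (∫⁻ η, k ξ η * (U η * V (ξ - η)) ∂μ) ^ 2 ∂μ
      ≤ C * ((∫⁻ η, U η ^ 2 ∂μ) * ∫⁻ η, V η ^ 2 ∂μ) := by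
  calc _ ≤ ∫⁻ ξ, C * ∫⁻ η, (U η * V (ξ - η)) ^ 2 ∂μ ∂μ := by
        refine lintegral_mono fun ξ => ?_
        refine (sq_lintegral_mul_le μ (hk.comp measurable_prodMk_left) (by fun_prop)).trans ?_
        gcongr
        exact hC ξ
    _ = C * ∫⁻ η, ∫⁻ ξ, (U η * V (ξ - η)) ^ 2 ∂μ ∂μ := by
        rw [lintegral_const_mul _ (by fun_prop), lintegral_lintegral_swap (by fun_prop)]
    _ = C * ∫⁻ η, U η ^ 2 * ∫⁻ ξ, V ξ ^ 2 ∂μ ∂μ := by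
        congr 1
        refine lintegral_congr fun η => ?_
        simp_rw [mul_pow]
        rw [lintegral_const_mul _ (by fun_prop), lintegral_sub_right_eq_self (fun ξ => V ξ ^ 2)]
    _ = _ := by rw [lintegral_mul_const _ (by fun_prop)]

/-- An `L²` bound for a weighted convolution whose kernel is uniformly square integrable in the
outer variable. -/
lemma lintegral_sq_convolution_le_of_outer [μ.IsNegInvariant] {k : E → E → ℝ≥0∞}
    (hk : Measurable (Function.uncurry k)) {U V : E → ℝ≥0∞} (hU : Measurable U)
    (hV : Measurable V) {C : ℝ≥0∞} (hC : ∀ η, ∫⁻ ξ, k ξ η ^ 2 ∂μ ≤ C) :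
    ∫⁻ ξ, (∫⁻ η, k ξ η * (U η * V (ξ - η)) ∂μ) ^ 2 ∂μ
      ≤ C * ((∫⁻ η, U η ^ 2 ∂μ) * ∫⁻ η, V η ^ 2 ∂μ) := by
  have hkξ (ξ : E) : Measurable (k ξ) := hk.comp measurable_prodMk_left
  have hkη (η : E) : Measurable fun ξ => k ξ η := hk.comp measurable_prodMk_right
  have hkU : Measurable (Function.uncurry fun ξ η => (k ξ η * U η) ^ 2) :=
    (hk.mul (hU.comp measurable_snd)).pow_const 2
  calc _ ≤ ∫⁻ ξ, (∫⁻ η, (k ξ η * U η) ^ 2 ∂μ) * ∫⁻ η, V η ^ 2 ∂μ ∂μ := by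
        refine lintegral_mono fun ξ => ?_
        simp_rw [← mul_assoc]
        refine (sq_lintegral_mul_le μ ((hkξ ξ).mul hU) (by fun_prop)).trans_eq ?_
        rw [lintegral_sub_left_eq_self (fun η => V η ^ 2)]
        rfl
    _ = (∫⁻ η, ∫⁻ ξ, (k ξ η * U η) ^ 2 ∂μ ∂μ) * ∫⁻ η, V η ^ 2 ∂μ := by
        rw [lintegral_mul_const _ hkU.lintegral_prod_right,
          lintegral_lintegral_swap hkU.aemeasurable]
    _ ≤ (∫⁻ η, C * U η ^ 2 ∂μ) * ∫⁻ η, V η ^ 2 ∂μ := by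
        gcongr with η
        simp_rw [mul_pow]
        rw [lintegral_mul_const _ ((hkη η).pow_const 2)]
        gcongr
        exact hC η
    _ = _ := by rw [lintegral_const_mul _ (by fun_prop), mul_assoc]

end Convolution

/-- The model kernel `⟨x⟩^(-α) ⟨y⟩^(-d)`, restricted to the region `⟨x⟩ ≤ ⟨y⟩`. -/
noncomputable def bracketKernel {E : Type*} [NormedAddCommGroup E] (α d : ℝ) (x y : E) : ℝ≥0∞ :=
  if jb x ≤ jb y then ENNReal.ofReal (jb x ^ (-α) * jb y ^ (-d)) else 0

lemma measurable_bracketKernel {E : Type*} [NormedAddCommGroup E] [MeasurableSpace E]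
    [BorelSpace E] [SecondCountableTopology E] (α d : ℝ) :
    Measurable (Function.uncurry (bracketKernel (E := E) α d)) := by
  refine Measurable.ite (measurableSet_le (by fun_prop) (by fun_prop)) ?_ measurable_const
  fun_prop

section Kernel

variable {E : Type*} [NormedAddCommGroup E]

lemma bracketKernel_of_le {α d : ℝ} {x y : E} (h : jb x ≤ jb y) :
    bracketKernel α d x y = ENNReal.ofReal (jb x ^ (-α) * jb y ^ (-d)) := if_pos h

lemma bracketKernel_of_not_le {α d : ℝ} {x y : E} (h : ¬ jb x ≤ jb y) :
    bracketKernel α d x y = 0 := if_neg h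

lemma rpow_mul_rpow_le_of_triangle {p q r : ℝ} (hp : 0 < p) (hq : 0 < q) (hr : 0 < r)
    (hpq : p ≤ q) (hpr : p ≤ r) (hqr : q ≤ p + r) (hrq : r ≤ p + q) (α β γ : ℝ) :
    p ^ (-α) * q ^ (-β) * r ^ (-γ) ≤ 2 ^ |β| * (p ^ (-α) * r ^ (-(β + γ))) := by
  have h := rpow_le_two_rpow_abs_mul hq hr (by linarith) (by linarith) (-β)
  rw [abs_neg] at h
  calc _ ≤ p ^ (-α) * (2 ^ |β| * r ^ (-β)) * r ^ (-γ) := by gcongr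
    _ = _ := by rw [neg_add, Real.rpow_add hr]; ring

/-- The kernel of the weighted convolution is dominated by the three model kernels, according to
which of the three frequencies is smallest. -/
lemma kernel_le_bracketKernel (a b s : ℝ) (ξ η : E) :
    ENNReal.ofReal (jb ξ ^ s * jb η ^ (-a) * jb (ξ - η) ^ (-b))
      ≤ ENNReal.ofReal (2 ^ (|a| + |b|)) * (bracketKernel a (b - s) η ξ
        + bracketKernel b (a - s) (ξ - η) ξ + bracketKernel (-s) (a + b) ξ η) := by
  have h1 : jb ξ ≤ jb η + jb (ξ - η) := by simpa using jb_add_le η (ξ - η)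
  have h2 : jb η ≤ jb ξ + jb (ξ - η) := by
    simpa [← jb_neg (ξ - η)] using jb_add_le ξ (-(ξ - η))
  have h3 : jb (ξ - η) ≤ jb ξ + jb η := by simpa [sub_eq_add_neg, jb_neg] using jb_add_le ξ (-η)
  have hξ := jb_pos ξ
  have hη := jb_pos η
  have hδ := jb_pos (ξ - η)
  have ha : (2 : ℝ) ^ |a| ≤ 2 ^ (|a| + |b|) :=
    Real.rpow_le_rpow_of_exponent_le one_le_two (by linarith [abs_nonneg b])
  have hb : (2 : ℝ) ^ |b| ≤ 2 ^ (|a| + |b|) :=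
    Real.rpow_le_rpow_of_exponent_le one_le_two (by linarith [abs_nonneg a])
  by_cases c1 : jb η ≤ jb ξ ∧ jb η ≤ jb (ξ - η)
  · have h := rpow_mul_rpow_le_of_triangle hη hδ hξ c1.2 c1.1 (by linarith) (by linarith) a b (-s)
    calc _ ≤ ENNReal.ofReal (2 ^ (|a| + |b|)) * bracketKernel a (b - s) η ξ := by
          rw [bracketKernel_of_le c1.1, ← ENNReal.ofReal_mul (by positivity)]
          refine ENNReal.ofReal_le_ofReal ?_
          calc _ = jb η ^ (-a) * jb (ξ - η) ^ (-b) * jb ξ ^ (- -s) := by rw [neg_neg]; ring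
            _ ≤ _ := h
            _ ≤ _ := by rw [← sub_eq_add_neg]; gcongr
      _ ≤ _ := by gcongr; rw [add_assoc]; exact le_self_add
  by_cases c2 : jb (ξ - η) ≤ jb ξ ∧ jb (ξ - η) ≤ jb η
  · have h := rpow_mul_rpow_le_of_triangle hδ hη hξ c2.2 c2.1 (by linarith) (by linarith) b a (-s)
    calc _ ≤ ENNReal.ofReal (2 ^ (|a| + |b|)) * bracketKernel b (a - s) (ξ - η) ξ := by
          rw [bracketKernel_of_le c2.1, ← ENNReal.ofReal_mul (by positivity)]
          refine ENNReal.ofReal_le_ofReal ?_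
          calc _ = jb (ξ - η) ^ (-b) * jb η ^ (-a) * jb ξ ^ (- -s) := by rw [neg_neg]; ring
            _ ≤ _ := h
            _ ≤ _ := by rw [← sub_eq_add_neg]; gcongr
      _ ≤ _ := by gcongr; exact le_add_right le_add_self
  have c3 : jb ξ ≤ jb η ∧ jb ξ ≤ jb (ξ - η) := by grind
  have h := rpow_mul_rpow_le_of_triangle hξ hδ hη c3.2 c3.1 (by linarith) (by linarith) (-s) b a
  calc _ ≤ ENNReal.ofReal (2 ^ (|a| + |b|)) * bracketKernel (-s) (a + b) ξ η := by
        rw [bracketKernel_of_le c3.1, ← ENNReal.ofReal_mul (by positivity)]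
        refine ENNReal.ofReal_le_ofReal ?_
        calc _ = jb ξ ^ (- -s) * jb (ξ - η) ^ (-b) * jb η ^ (-a) := by rw [neg_neg]; ring
          _ ≤ _ := h
          _ ≤ _ := by rw [add_comm b a]; gcongr
    _ ≤ _ := by gcongr; exact le_add_self

end Kernel

section Haar

open Module

variable {E : Type*} [NormedAddCommGroup E] [NormedSpace ℝ E] [FiniteDimensional ℝ E]
  [MeasurableSpace E] [BorelSpace E] (μ : Measure E) [μ.IsAddHaarMeasure]

/-- The exact growth of `∫_{|x| < R} |x|^(-p)` below the critical exponent. -/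
lemma exists_setLIntegral_ball_norm_rpow_le [Nontrivial E] {p : ℝ} (hp : p < finrank ℝ E) :
    ∃ C : ℝ, 0 ≤ C ∧ ∀ R : ℝ, 0 < R →
      ∫⁻ x in Metric.ball (0 : E) R, ENNReal.ofReal (‖x‖ ^ (-p)) ∂μ
        ≤ ENNReal.ofReal (C * R ^ ((finrank ℝ E : ℝ) - p)) := by
  have hdim : 0 < finrank ℝ E := finrank_pos
  have hpow (y : ℝ) (hy : 0 < y) :
      y ^ (finrank ℝ E - 1) • y ^ (-p) = y ^ ((finrank ℝ E : ℝ) - 1 - p) := by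
    rw [smul_eq_mul, ← Real.rpow_natCast, ← Real.rpow_add hy, Nat.cast_sub hdim]
    push_cast
    congr 1
  refine ⟨finrank ℝ E * μ.real (Metric.ball 0 1) * (1 / (finrank ℝ E - p)), ?_, fun R hR => ?_⟩
  · have : 0 < finrank ℝ E - p := by linarith
    positivity
  have hint : IntegrableOn (fun x : E => ‖x‖ ^ (-p)) (Metric.ball 0 R) μ := by
    rw [integrableOn_fun_norm_addHaar μ (f := fun y => y ^ (-p)),
      integrableOn_congr_fun (fun y hy => hpow y hy.1) measurableSet_Ioo,
      intervalIntegral.integrableOn_Ioo_rpow_iff hR]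
    linarith
  rw [← ofReal_integral_eq_lintegral_ofReal hint (.of_forall fun x => by positivity)]
  refine ENNReal.ofReal_le_ofReal (le_of_eq ?_)
  calc _ = ∫ x : E, (Set.Iio R).indicator (fun y => y ^ (-p)) ‖x‖ ∂μ := by
        rw [← integral_indicator measurableSet_ball]
        congr with x
        simp [Set.indicator]
    _ = finrank ℝ E • μ.real (Metric.ball 0 1) •
        ∫ y in Set.Ioi (0 : ℝ), (Set.Iio R).indicator
          (fun y => y ^ ((finrank ℝ E : ℝ) - 1 - p)) y := by
        rw [integral_fun_norm_addHaar]
        congr 2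
        refine setIntegral_congr_fun measurableSet_Ioi fun y hy => ?_
        by_cases h : y < R
        · simpa [h] using hpow y hy
        · simp [h]
    _ = _ := by
        rw [setIntegral_indicator measurableSet_Iio, Set.Ioi_inter_Iio,
          ← integral_Ioc_eq_integral_Ioo, ← intervalIntegral.integral_of_le hR.le,
          integral_rpow (Or.inl (by linarith))]
        have h : (finrank ℝ E : ℝ) - 1 - p + 1 = finrank ℝ E - p := by ring
        rw [h, Real.zero_rpow (by linarith)]
        simp only [nsmul_eq_mul, smul_eq_mul]
        ring

/-- The model kernel is uniformly square integrable in its low-frequency variable. -/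
lemma exists_lintegral_bracketKernel_sq_le {α d : ℝ} (hd : 0 ≤ d)
    (hαd : (finrank ℝ E : ℝ) / 2 ≤ α + d)
    (hcrit : α = (finrank ℝ E : ℝ) / 2 → (finrank ℝ E : ℝ) / 2 < α + d) :
    ∃ C : ℝ≥0∞, C ≠ ∞ ∧ ∀ y : E, ∫⁻ x, bracketKernel α d x y ^ 2 ∂μ ≤ C := by
  rcases subsingleton_or_nontrivial E with hE | hE
  · refine ⟨∫⁻ _, 1 ∂μ, ?_, fun y => lintegral_mono fun x => ?_⟩
    · rw [lintegral_one, Set.subsingleton_univ.eq_singleton_of_mem (Set.mem_univ 0)]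
      exact isCompact_singleton.measure_ne_top
    · simp [bracketKernel, Subsingleton.elim x 0, Subsingleton.elim y 0, jb]
  rcases hαd.lt_or_eq with hlt | heq
  · have hint : Integrable (fun x : E => jb x ^ (-(2 * (α + d)))) μ := by
      simp_rw [jb_rpow_eq]
      exact integrable_rpow_neg_one_add_norm_sq (by linarith)
    refine ⟨_, hint.lintegral_lt_top.ne, fun y => lintegral_mono fun x => ?_⟩
    by_cases h : jb x ≤ jb y
    · rw [bracketKernel_of_le h, show -(2 * (α + d)) = 2 * (-α + -d) by ring,
        ofReal_rpow_two_mul (jb_pos x).le, Real.rpow_add (jb_pos x)]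
      have hx := jb_pos x
      gcongr ENNReal.ofReal (_ * ?_) ^ 2
      exact Real.rpow_le_rpow_of_nonpos hx h (by linarith)
    · simp [bracketKernel_of_not_le h]
  · have hα : α < (finrank ℝ E : ℝ) / 2 := by
      refine lt_of_le_of_ne (by linarith) fun h => ?_
      linarith [hcrit h]
    have hdim : (0 : ℝ) < finrank ℝ E := by exact_mod_cast finrank_pos (R := ℝ) (M := E)
    set β := max α 0
    have hβα : α ≤ β := le_max_left _ _
    have hβ0 : 0 ≤ β := le_max_right _ _
    obtain ⟨C, hC, hball⟩ := exists_setLIntegral_ball_norm_rpow_le (E := E) μ (p := 2 * β)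
      (by linarith [max_lt hα (half_pos hdim)])
    refine ⟨ENNReal.ofReal C, ENNReal.ofReal_ne_top, fun y => ?_⟩
    have hy := jb_pos y
    have hpt : ∀ᵐ x ∂μ, bracketKernel α d x y ^ 2 ≤
        (Metric.ball 0 (jb y)).indicator (fun x => ENNReal.ofReal (jb y ^ (2 * (β - α - d))) *
          ENNReal.ofReal (‖x‖ ^ (-(2 * β)))) x := by
      filter_upwards [Measure.ae_ne μ 0] with x hx0
      by_cases h : jb x ≤ jb y
      · have hx := jb_pos x
        have hmem : x ∈ Metric.ball (0 : E) (jb y) := by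
          simpa using (norm_lt_jb x).trans_le h
        rw [Set.indicator_of_mem hmem, bracketKernel_of_le h, ← ENNReal.ofReal_mul (by positivity),
          ← ENNReal.ofReal_pow (by positivity)]
        refine ENNReal.ofReal_le_ofReal ?_
        rw [← Real.rpow_two, Real.mul_rpow (by positivity) (by positivity),
          ← Real.rpow_mul hx.le, ← Real.rpow_mul hy.le]
        calc _ = jb x ^ (2 * (β - α)) * jb x ^ (-(2 * β)) * jb y ^ (-(2 * d)) := by
              rw [← Real.rpow_add hx]; ring_nf
          _ ≤ jb y ^ (2 * (β - α)) * ‖x‖ ^ (-(2 * β)) * jb y ^ (-(2 * d)) := by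
              gcongr ?_ * ?_ * _
              · exact Real.rpow_le_rpow hx.le h (by linarith)
              · exact Real.rpow_le_rpow_of_nonpos (norm_pos_iff.2 hx0) (norm_lt_jb x).le
                  (by linarith)
          _ = jb y ^ (2 * (β - α) + -(2 * d)) * ‖x‖ ^ (-(2 * β)) := by
              rw [Real.rpow_add hy]; ring
          _ = _ := by ring_nf
      · simp [bracketKernel_of_not_le h]
    calc _ ≤ _ := lintegral_mono_ae hpt
      _ = ENNReal.ofReal (jb y ^ (2 * (β - α - d))) *
          ∫⁻ x in Metric.ball (0 : E) (jb y), ENNReal.ofReal (‖x‖ ^ (-(2 * β))) ∂μ := by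
        rw [lintegral_indicator measurableSet_ball, lintegral_const_mul _ (by fun_prop)]
      _ ≤ ENNReal.ofReal (jb y ^ (2 * (β - α - d))) *
          ENNReal.ofReal (C * jb y ^ ((finrank ℝ E : ℝ) - 2 * β)) := by
        gcongr
        exact hball _ hy
      _ = _ := by
        rw [← ENNReal.ofReal_mul (by positivity), mul_left_comm, ← Real.rpow_add hy,
          show 2 * (β - α - d) + ((finrank ℝ E : ℝ) - 2 * β) = 0 by linarith, Real.rpow_zero,
          mul_one]

end Haar

lemma add_add_sq_le_three_mul (x y z : ℝ≥0∞) :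
    (x + y + z) ^ 2 ≤ 3 * (x ^ 2 + y ^ 2 + z ^ 2) := by
  by_cases hx : x = ∞
  · simp [hx]
  by_cases hy : y = ∞
  · simp [hy]
  by_cases hz : z = ∞
  · simp [hz]
  lift x to NNReal using hx
  lift y to NNReal using hy
  lift z to NNReal using hz
  norm_cast
  rw [← NNReal.coe_le_coe]
  push_cast
  nlinarith [sq_nonneg (x - y : ℝ), sq_nonneg (y - z : ℝ), sq_nonneg (x - z : ℝ)]

section Weighted

open Module

variable {E : Type*} [NormedAddCommGroup E] [NormedSpace ℝ E] [FiniteDimensional ℝ E]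
  [MeasurableSpace E] [BorelSpace E] (μ : Measure E) [μ.IsAddHaarMeasure]

/-- The `L²` bound for the convolution with kernel `⟨ξ⟩^s ⟨η⟩^(-a) ⟨ξ - η⟩^(-b)`. -/
lemma exists_lintegral_sq_bracket_convolution_le {a b s : ℝ} (hab : 0 ≤ a + b)
    (hs_min : s ≤ min a b) (hs : s ≤ a + b - (finrank ℝ E : ℝ) / 2)
    (hstrict : (-s = (finrank ℝ E : ℝ) / 2 ∨ a = (finrank ℝ E : ℝ) / 2 ∨
      b = (finrank ℝ E : ℝ) / 2) → s < a + b - (finrank ℝ E : ℝ) / 2) :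
    ∃ C : ℝ≥0∞, C ≠ ∞ ∧ ∀ U V : E → ℝ≥0∞, Measurable U → Measurable V →
      ∫⁻ ξ, (∫⁻ η, ENNReal.ofReal (jb ξ ^ s * jb η ^ (-a) * jb (ξ - η) ^ (-b)) *
          (U η * V (ξ - η)) ∂μ) ^ 2 ∂μ
        ≤ C * ((∫⁻ η, U η ^ 2 ∂μ) * ∫⁻ η, V η ^ 2 ∂μ) := by
  obtain ⟨hsa, hsb⟩ := le_min_iff.1 hs_min
  obtain ⟨C₁, hC₁, h₁⟩ := exists_lintegral_bracketKernel_sq_le μ (α := a) (d := b - s)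
    (by linarith) (by linarith) (fun h => by linarith [hstrict (.inr (.inl h))])
  obtain ⟨C₂, hC₂, h₂⟩ := exists_lintegral_bracketKernel_sq_le μ (α := b) (d := a - s)
    (by linarith) (by linarith) (fun h => by linarith [hstrict (.inr (.inr h))])
  obtain ⟨C₃, hC₃, h₃⟩ := exists_lintegral_bracketKernel_sq_le μ (α := -s) (d := a + b)
    (by linarith) (by linarith) (fun h => by linarith [hstrict (.inl h)])
  set M := ENNReal.ofReal (2 ^ (|a| + |b|))
  refine ⟨M ^ 2 * (3 * (C₁ + C₂ + C₃)), by finiteness, fun U V hU hV => ?_⟩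
  set k₁ : E → E → ℝ≥0∞ := fun ξ η => bracketKernel a (b - s) η ξ
  set k₂ : E → E → ℝ≥0∞ := fun ξ η => bracketKernel b (a - s) (ξ - η) ξ with hk₂
  set k₃ : E → E → ℝ≥0∞ := fun ξ η => bracketKernel (-s) (a + b) ξ η
  have m₁ : Measurable (Function.uncurry k₁) :=
    (measurable_bracketKernel a (b - s)).comp measurable_swap
  have m₂ : Measurable (Function.uncurry k₂) :=
    (measurable_bracketKernel b (a - s)).comp
      ((measurable_fst.sub measurable_snd).prodMk measurable_fst)
  have m₃ : Measurable (Function.uncurry k₃) := measurable_bracketKernel (-s) (a + b)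
  have hUV : Measurable fun p : E × E => U p.2 * V (p.1 - p.2) := by fun_prop
  have mc {k : E → E → ℝ≥0∞} (hk : Measurable (Function.uncurry k)) :
      Measurable fun ξ => ∫⁻ η, k ξ η * (U η * V (ξ - η)) ∂μ :=
    (hk.mul hUV).lintegral_prod_right
  have mi {k : E → E → ℝ≥0∞} (hk : Measurable (Function.uncurry k)) (ξ : E) :
      Measurable fun η => k ξ η * (U η * V (ξ - η)) :=
    (hk.mul hUV).comp measurable_prodMk_left
  have hB₁ := lintegral_sq_convolution_le_of_inner m₁ hU hV h₁
  have hB₂ := lintegral_sq_convolution_le_of_inner m₂ hU hV (C := C₂) (μ := μ) fun ξ => by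
    rw [hk₂, lintegral_sub_left_eq_self (fun η => bracketKernel b (a - s) η ξ ^ 2)]
    exact h₂ ξ
  have hB₃ := lintegral_sq_convolution_le_of_outer m₃ hU hV h₃
  calc _ ≤ ∫⁻ ξ, (M * ((∫⁻ η, k₁ ξ η * (U η * V (ξ - η)) ∂μ)
          + (∫⁻ η, k₂ ξ η * (U η * V (ξ - η)) ∂μ)
          + ∫⁻ η, k₃ ξ η * (U η * V (ξ - η)) ∂μ)) ^ 2 ∂μ := by
        gcongr with ξ
        rw [← lintegral_add_right _ (mi m₂ ξ), ← lintegral_add_right _ (mi m₃ ξ),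
          ← lintegral_const_mul _ (((mi m₁ ξ).fun_add (mi m₂ ξ)).fun_add (mi m₃ ξ))]
        refine lintegral_mono fun η => ?_
        rw [← add_mul, ← add_mul, ← mul_assoc M]
        gcongr
        exact kernel_le_bracketKernel a b s ξ η
    _ ≤ ∫⁻ ξ, M ^ 2 * (3 * ((∫⁻ η, k₁ ξ η * (U η * V (ξ - η)) ∂μ) ^ 2
          + (∫⁻ η, k₂ ξ η * (U η * V (ξ - η)) ∂μ) ^ 2
          + (∫⁻ η, k₃ ξ η * (U η * V (ξ - η)) ∂μ) ^ 2)) ∂μ := by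
        gcongr with ξ
        rw [mul_pow]
        gcongr
        exact add_add_sq_le_three_mul _ _ _
    _ = M ^ 2 * (3 * ((∫⁻ ξ, (∫⁻ η, k₁ ξ η * (U η * V (ξ - η)) ∂μ) ^ 2 ∂μ)
          + (∫⁻ ξ, (∫⁻ η, k₂ ξ η * (U η * V (ξ - η)) ∂μ) ^ 2 ∂μ)
          + ∫⁻ ξ, (∫⁻ η, k₃ ξ η * (U η * V (ξ - η)) ∂μ) ^ 2 ∂μ)) := by
        have n₁ := (mc m₁).pow_const 2
        have n₂ := (mc m₂).pow_const 2
        have n₃ := (mc m₃).pow_const 2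
        rw [lintegral_const_mul _ (((n₁.fun_add n₂).fun_add n₃).const_mul 3),
          lintegral_const_mul _ ((n₁.fun_add n₂).fun_add n₃), lintegral_add_right _ n₃,
          lintegral_add_right _ n₂]
    _ ≤ M ^ 2 * (3 * (C₁ * ((∫⁻ η, U η ^ 2 ∂μ) * ∫⁻ η, V η ^ 2 ∂μ)
          + C₂ * ((∫⁻ η, U η ^ 2 ∂μ) * ∫⁻ η, V η ^ 2 ∂μ)
          + C₃ * ((∫⁻ η, U η ^ 2 ∂μ) * ∫⁻ η, V η ^ 2 ∂μ))) := by gcongr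
    _ = _ := by ring

end Weighted

lemma SchwartzMap.enorm_fourier_mul_le {E : Type*} [NormedAddCommGroup E] [InnerProductSpace ℝ E]
    [FiniteDimensional ℝ E] [MeasurableSpace E] [BorelSpace E] (f g : SchwartzMap E ℂ) (ξ : E) :
    ‖𝓕 (fun x => f x * g x) ξ‖ₑ ≤ ∫⁻ η, ‖𝓕 (⇑f) η‖ₑ * ‖𝓕 (⇑g) (ξ - η)‖ₑ := by
  set B := ContinuousLinearMap.mul ℂ ℂ
  have h : 𝓕 (fun x => f x * g x) ξ = (SchwartzMap.convolution B (𝓕⁻ f) (𝓕⁻ g)) (-ξ) := by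
    have h1 : SchwartzMap.convolution B (𝓕⁻ f) (𝓕⁻ g) = 𝓕⁻ (SchwartzMap.pairing B f g) := by
      simp [SchwartzMap.convolution]
    rw [h1, SchwartzMap.fourierInv_coe, Real.fourierInv_eq_fourier_neg, neg_neg]
    rfl
  rw [h, SchwartzMap.convolution_apply, MeasureTheory.convolution]
  refine (enorm_integral_le_lintegral_enorm _).trans_eq ?_
  rw [← lintegral_neg_eq_self]
  refine lintegral_congr fun η => ?_
  rw [SchwartzMap.fourierInv_coe, SchwartzMap.fourierInv_coe, Real.fourierInv_eq_fourier_neg,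
    Real.fourierInv_eq_fourier_neg]
  simp [B, sub_eq_add_neg, add_comm]

theorem stmt_14 (m : ℕ) (a b s : ℝ)
    (hab : 0 ≤ a + b) (hs_min : s ≤ min a b) (hs : s ≤ a + b - (m : ℝ) / 2)
    (hstrict : (-s = (m : ℝ) / 2 ∨ a = (m : ℝ) / 2 ∨ b = (m : ℝ) / 2) →
      s < a + b - (m : ℝ) / 2) :
    ∃ C : ℝ, 0 < C ∧
      ∀ f g : SchwartzMap (EuclideanSpace ℝ (Fin m)) ℂ,
        (∫⁻ ξ, ENNReal.ofReal (jb ξ ^ (2 * s))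
            * (‖𝓕 (fun x => f x * g x) ξ‖₊ : ℝ≥0∞) ^ 2) ^ (1 / 2 : ℝ)
          ≤ ENNReal.ofReal C
            * (∫⁻ ξ, ENNReal.ofReal (jb ξ ^ (2 * a)) * (‖𝓕 (⇑f) ξ‖₊ : ℝ≥0∞) ^ 2) ^ (1 / 2 : ℝ)
            * (∫⁻ ξ, ENNReal.ofReal (jb ξ ^ (2 * b)) * (‖𝓕 (⇑g) ξ‖₊ : ℝ≥0∞) ^ 2) ^ (1 / 2 : ℝ) := by
  obtain ⟨C, hC, hbound⟩ := exists_lintegral_sq_bracket_convolution_le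
    (volume : Measure (EuclideanSpace ℝ (Fin m))) hab hs_min (by simpa using hs)
    (by simpa using hstrict)
  refine ⟨(C ^ (1 / 2 : ℝ)).toReal + 1, by positivity, fun f g => ?_⟩
  set U : EuclideanSpace ℝ (Fin m) → ℝ≥0∞ :=
    fun η => ENNReal.ofReal (jb η ^ a) * ‖𝓕 (⇑f) η‖ₑ with hU
  set V : EuclideanSpace ℝ (Fin m) → ℝ≥0∞ :=
    fun η => ENNReal.ofReal (jb η ^ b) * ‖𝓕 (⇑g) η‖ₑ with hV
  have cf : Continuous (𝓕 (⇑f)) := (𝓕 f).continuous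
  have cg : Continuous (𝓕 (⇑g)) := (𝓕 g).continuous
  have mf : Measurable fun η => ‖𝓕 (⇑f) η‖ₑ := cf.measurable.enorm
  have mg : Measurable fun η => ‖𝓕 (⇑g) η‖ₑ := cg.measurable.enorm
  have hpt (ξ : EuclideanSpace ℝ (Fin m)) :
      ENNReal.ofReal (jb ξ ^ s) * ‖𝓕 (fun x => f x * g x) ξ‖ₑ ≤
        ∫⁻ η, ENNReal.ofReal (jb ξ ^ s * jb η ^ (-a) * jb (ξ - η) ^ (-b)) *
          (U η * V (ξ - η)) := by
    calc _ ≤ ENNReal.ofReal (jb ξ ^ s) * ∫⁻ η, ‖𝓕 (⇑f) η‖ₑ * ‖𝓕 (⇑g) (ξ - η)‖ₑ := by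
          gcongr
          exact SchwartzMap.enorm_fourier_mul_le f g ξ
      _ = _ := by
          rw [← lintegral_const_mul _ (by fun_prop)]
          refine lintegral_congr fun η => ?_
          have h0 := jb_pos ξ
          have h1 := jb_pos η
          have h2 := jb_pos (ξ - η)
          have e1 : ENNReal.ofReal (jb η ^ (-a)) * ENNReal.ofReal (jb η ^ a) = 1 := by
            rw [← ENNReal.ofReal_mul (by positivity), ← Real.rpow_add h1]
            simp
          have e2 : ENNReal.ofReal (jb (ξ - η) ^ (-b)) * ENNReal.ofReal (jb (ξ - η) ^ b) = 1 := by
            rw [← ENNReal.ofReal_mul (by positivity), ← Real.rpow_add h2]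
            simp
          rw [ENNReal.ofReal_mul (by positivity), ENNReal.ofReal_mul (by positivity)]
          calc _ = ENNReal.ofReal (jb ξ ^ s) *
                (ENNReal.ofReal (jb η ^ (-a)) * ENNReal.ofReal (jb η ^ a)) *
                (ENNReal.ofReal (jb (ξ - η) ^ (-b)) * ENNReal.ofReal (jb (ξ - η) ^ b)) *
                (‖𝓕 (⇑f) η‖ₑ * ‖𝓕 (⇑g) (ξ - η)‖ₑ) := by rw [e1, e2, mul_one, mul_one]
            _ = _ := by simp only [hU, hV]; ring
  have hweight (r : ℝ) (h : EuclideanSpace ℝ (Fin m) → ℂ) :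
      ∫⁻ ξ, ENNReal.ofReal (jb ξ ^ (2 * r)) * (‖h ξ‖₊ : ℝ≥0∞) ^ 2 =
        ∫⁻ ξ, (ENNReal.ofReal (jb ξ ^ r) * ‖h ξ‖ₑ) ^ 2 := by
    simp_rw [mul_pow, ofReal_rpow_two_mul (jb_pos _).le]
    rfl
  rw [hweight, hweight, hweight]
  have hconst : C ^ (1 / 2 : ℝ) ≤ ENNReal.ofReal ((C ^ (1 / 2 : ℝ)).toReal + 1) := by
    rw [← ENNReal.ofReal_toReal (a := C ^ (1 / 2 : ℝ)) (by finiteness)]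
    exact ENNReal.ofReal_le_ofReal (by simp)
  calc _ ≤ (C * ((∫⁻ η, U η ^ 2) * ∫⁻ η, V η ^ 2)) ^ (1 / 2 : ℝ) := by
        gcongr
        refine le_trans ?_ (hbound U V (by fun_prop) (by fun_prop))
        gcongr with ξ
        exact hpt ξ
    _ = C ^ (1 / 2 : ℝ) * (∫⁻ η, U η ^ 2) ^ (1 / 2 : ℝ) * (∫⁻ η, V η ^ 2) ^ (1 / 2 : ℝ) := by
        rw [ENNReal.mul_rpow_of_nonneg _ _ (by norm_num),
          ENNReal.mul_rpow_of_nonneg _ _ (by norm_num), mul_assoc]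
    _ ≤ _ := by gcongr
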